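/- arXiv:2307.00346 — 2 statements merged into one kernel-verified Lean document; each statement's English description precedes it below -/
import Mathlib

section
/- For all positive integers n and s, Σ_{a=1, (a, n^s)_s = 1}^{n^s} (a − 1, n^s)_s = Φ_s(n^s) · τ_s(n^s), where the sum is over integers a in [1, n^s] with (a, n^s)_s = 1. -/
open scoped Classical

/-- The generalized gcd `(a, b)_s`: the largest positive integer of the form `l ^ s`
(`l ∈ ℕ`) dividing both `a` and `b`. -/
noncomputable def sgcd (s : ℕ) (a b : ℤ) : ℕ :=
  sSup {m : ℕ | 0 < m ∧ (∃ l : ℕ, m = l ^ s) ∧ (m : ℤ) ∣ a ∧ (m : ℤ) ∣ b}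

/-- Klee's function `Φ_s(n)`: the number of `m` with `1 ≤ m ≤ n` and `(m, n)_s = 1`. -/
noncomputable def klee (s n : ℕ) : ℕ :=
  ((Finset.Icc 1 n).filter (fun m => sgcd s (m : ℤ) (n : ℤ) = 1)).card
/-- `τ_s(N)`: the number of positive integers `d` such that `d ^ s` divides `N`. -/
def tauS (s N : ℕ) : ℕ := (N.divisors.filter (fun d => d ^ s ∣ N)).card

open Finset

/-- The largest `d ∣ n` with `d ^ s ∣ a`, defined as the lcm of all such `d`. -/
def sroot (s n a : ℕ) : ℕ := (n.divisors.filter (fun d => d ^ s ∣ a)).lcm id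

/-- No prime `p ∣ n` satisfies `p ^ s ∣ a`; equivalently `(a, n ^ s)_s = 1`. -/
def SCoprime (s n a : ℕ) : Prop := ∀ p, p.Prime → p ∣ n → ¬ p ^ s ∣ a

/-- Jordan's totient as a count of residues. -/
noncomputable def jordan (s n : ℕ) : ℕ := ((range (n ^ s)).filter (SCoprime s n)).card

lemma sroot_dvd (s n a : ℕ) : sroot s n a ∣ n :=
  Finset.lcm_dvd fun _ hd => Nat.dvd_of_mem_divisors (mem_filter.1 hd).1

lemma lcm_pow_dvd {s a : ℕ} {S : Finset ℕ} (h : ∀ e ∈ S, e ^ s ∣ a) : (S.lcm id) ^ s ∣ a := by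
  induction S using Finset.induction_on with
  | empty => simp
  | insert d S _ ih =>
    rw [Finset.lcm_insert, id_eq, lcm_eq_nat_lcm, ← Nat.pow_lcm_pow]
    exact Nat.lcm_dvd (h d (mem_insert_self _ _)) (ih fun e he => h e (mem_insert_of_mem he))

lemma sroot_pow_dvd (s n a : ℕ) : sroot s n a ^ s ∣ a :=
  lcm_pow_dvd fun _ hd => (mem_filter.1 hd).2

lemma dvd_sroot_iff {s n a d : ℕ} (hn : 0 < n) (hd : d ∣ n) : d ∣ sroot s n a ↔ d ^ s ∣ a := by
  refine ⟨fun h => (pow_dvd_pow_of_dvd h s).trans (sroot_pow_dvd s n a), fun h => ?_⟩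
  exact Finset.dvd_lcm (f := id) (mem_filter.2 ⟨Nat.mem_divisors.2 ⟨hd, hn.ne'⟩, h⟩)

lemma sroot_pos {s n a : ℕ} (hn : 0 < n) : 0 < sroot s n a :=
  Nat.pos_of_dvd_of_pos (sroot_dvd s n a) hn

lemma sgcd_eq_sroot_pow {n s : ℕ} (hn : 0 < n) (hs : 0 < s) (a : ℤ) :
    sgcd s a ((n : ℤ) ^ s) = sroot s n a.natAbs ^ s := by
  refine IsGreatest.csSup_eq ⟨⟨pow_pos (sroot_pos hn) s, ⟨_, rfl⟩, ?_, ?_⟩, ?_⟩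
  · exact Int.natCast_dvd.2 (sroot_pow_dvd s n _)
  · exact_mod_cast pow_dvd_pow_of_dvd (sroot_dvd s n _) s
  · rintro _ ⟨_, ⟨l, rfl⟩, hla, hln⟩
    have hl : l ∣ n := (Nat.pow_dvd_pow_iff hs.ne').1 (by exact_mod_cast hln)
    exact Nat.pow_le_pow_left (Nat.le_of_dvd (sroot_pos hn)
      ((dvd_sroot_iff hn hl).2 (Int.natCast_dvd.1 hla))) s

lemma sroot_eq_one_iff {s n a : ℕ} (hn : 0 < n) : sroot s n a = 1 ↔ SCoprime s n a := by
  refine ⟨fun h p hp hpn hpa => ?_, fun h => ?_⟩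
  · exact hp.one_lt.ne' (Nat.dvd_one.1 (h ▸ (dvd_sroot_iff hn hpn).2 hpa))
  · by_contra hne
    obtain ⟨p, hp, hpr⟩ := Nat.exists_prime_and_dvd hne
    have hpn := hpr.trans (sroot_dvd s n a)
    exact h p hp hpn ((dvd_sroot_iff hn hpn).1 hpr)

lemma sgcd_eq_one_iff {n s : ℕ} (hn : 0 < n) (hs : 0 < s) (a : ℕ) :
    sgcd s (a : ℤ) ((n : ℤ) ^ s) = 1 ↔ SCoprime s n a := by
  rw [sgcd_eq_sroot_pow hn hs, pow_eq_one_iff_left hs.ne', Int.natAbs_natCast, sroot_eq_one_iff hn]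

lemma SCoprime.of_modEq {s n a b m : ℕ} (h : SCoprime s n a)
    (hab : a ≡ b [MOD m ^ s]) (hnm : n ∣ m) : SCoprime s n b := fun p hp hpn hpb =>
  h p hp hpn ((hab.dvd_iff (pow_dvd_pow_of_dvd (hpn.trans hnm) s)).2 hpb)

lemma card_filter_Icc_one_eq_range {N : ℕ} {p : ℕ → Prop} [DecidablePred p]
    (hp : Function.Periodic p N) :
    ((Icc 1 N).filter p).card = ((range N).filter p).card := by
  have h := Nat.filter_Ico_card_eq_of_periodic 1 N p hp
  rw [Nat.count_eq_card_filter_range] at h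
  rw [← h]
  congr 2
  ext; simp only [mem_Icc, mem_Ico]; omega

lemma card_filter_range_add {N : ℕ} {p : ℕ → Prop} [DecidablePred p]
    (hp : Function.Periodic p N) (t : ℕ) :
    ((range N).filter (fun a => p (a + t))).card = ((range N).filter p).card := by
  have h := Nat.filter_Ico_card_eq_of_periodic t N p hp
  rw [Nat.count_eq_card_filter_range] at h
  rw [← h]
  refine card_bij' (fun a _ => a + t) (fun a _ => a - t) ?_ ?_ ?_ ?_ <;>
    simp only [mem_filter, mem_range, mem_Ico]
  · rintro a ⟨h1, h2⟩; exact ⟨by omega, h2⟩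
  · rintro a ⟨h1, h2⟩; exact ⟨by omega, by rwa [Nat.sub_add_cancel h1.1]⟩
  · intros; omega
  · intros; omega

lemma periodic_sCoprime {s n d : ℕ} (hd : d ∣ n) (c : ℕ) :
    Function.Periodic (fun a => SCoprime s n a ∧ a ≡ c [MOD d ^ s]) (n ^ s) := fun a => by
  have h : a + n ^ s ≡ a [MOD n ^ s] := by simp [Nat.ModEq]
  have h' := h.of_dvd (pow_dvd_pow_of_dvd hd s)
  exact propext ⟨fun ⟨h1, h2⟩ => ⟨h1.of_modEq h dvd_rfl, h'.symm.trans h2⟩,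
    fun ⟨h1, h2⟩ => ⟨h1.of_modEq h.symm dvd_rfl, h'.trans h2⟩⟩

/-- The monadic coercion of a `Finset ℕ` to `Finset ℤ` is its image under the cast. -/
lemma bind_pure_natCast (S : Finset ℕ) :
    (S >>= fun a => pure (a : ℤ)) = S.map Nat.castEmbedding := by
  ext x
  simp [Finset.bind_def, Finset.pure_def, eq_comm]

lemma klee_eq_jordan {n s : ℕ} (hn : 0 < n) (hs : 0 < s) : klee s (n ^ s) = jordan s n := by
  have hp : Function.Periodic (SCoprime s n) (n ^ s) := by
    simpa [Nat.modEq_one] using periodic_sCoprime (s := s) (one_dvd n) 0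
  rw [klee, jordan, ← card_filter_Icc_one_eq_range hp]
  rw [bind_pure_natCast, filter_map, card_map]
  refine congrArg card (filter_congr fun a _ => ?_)
  rw [Function.comp_apply, Nat.castEmbedding_apply, Nat.cast_pow, sgcd_eq_one_iff hn hs]

/-- Every `s`-coprime class modulo `d ^ s` has equally many `s`-coprime lifts modulo `n ^ s`. -/
lemma card_lifts_eq {n s d c c' : ℕ} (hn : 0 < n) (hd : d ∣ n)
    (hc : SCoprime s d c) (hc' : SCoprime s d c') :
    ((range (n ^ s)).filter (fun a => SCoprime s n a ∧ a ≡ c [MOD d ^ s])).card =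
      ((range (n ^ s)).filter (fun a => SCoprime s n a ∧ a ≡ c' [MOD d ^ s])).card := by
  set P := ∏ p ∈ n.primeFactors with ¬ p ∣ d, p
  have hcop : Nat.Coprime (d ^ s) (P ^ s) := by
    refine Nat.Coprime.pow _ _ (Nat.Coprime.prod_right fun p hp => ?_)
    simp only [mem_filter, Nat.mem_primeFactors] at hp
    exact ((Nat.Prime.coprime_iff_not_dvd hp.1.1).2 hp.2).symm
  have hdpos : 0 < d ^ s := pow_pos (Nat.pos_of_dvd_of_pos hd hn) s
  obtain ⟨t, ht, htP⟩ := Nat.chineseRemainder hcop (c' + (d ^ s - 1) * c) 0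
  rw [← card_filter_range_add (periodic_sCoprime hd c') t]
  congr 1
  refine filter_congr fun a _ => ?_
  have hmod : c + t ≡ c' [MOD d ^ s] := by
    have h1 : c + (c' + (d ^ s - 1) * c) = c' + d ^ s * c := by
      obtain ⟨k, hk⟩ : ∃ k, d ^ s = k + 1 := ⟨d ^ s - 1, by omega⟩
      rw [hk, Nat.add_sub_cancel]; ring
    have h2 := ht.add_left c
    rw [h1] at h2
    exact h2.trans (by simp [Nat.ModEq])
  have hiff : a ≡ c [MOD d ^ s] ↔ a + t ≡ c' [MOD d ^ s] :=
    ⟨fun h => (h.add_right t).trans hmod,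
      fun h => Nat.ModEq.add_right_cancel' t (h.trans hmod.symm)⟩
  rw [← hiff]
  refine and_congr_left fun h => forall_congr' fun p => forall_congr' fun hp =>
    forall_congr' fun hpn => not_congr ?_
  by_cases hpd : p ∣ d
  · have hps := pow_dvd_pow_of_dvd hpd s
    exact iff_of_false (fun h0 => hc p hp hpd ((h.dvd_iff hps).1 h0))
      (fun h0 => hc' p hp hpd (((hiff.1 h).dvd_iff hps).1 h0))
  · have hpP : p ∣ P := dvd_prod_of_mem _
      (mem_filter.2 ⟨Nat.mem_primeFactors.2 ⟨hp, hpn, hn.ne'⟩, hpd⟩)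
    have hpt : p ^ s ∣ t :=
      (pow_dvd_pow_of_dvd hpP s).trans ((Nat.modEq_zero_iff_dvd).1 htP)
    exact (Nat.dvd_add_left hpt).symm

lemma sCoprime_one {s n : ℕ} (hs : 0 < s) : SCoprime s n 1 := fun _ hp _ h =>
  hp.one_lt.ne' ((pow_eq_one_iff_left hs.ne').1 (Nat.dvd_one.1 h))

lemma jordan_mul_card_lifts {n s d : ℕ} (hn : 0 < n) (hs : 0 < s) (hd : d ∣ n) :
    jordan s d * ((range (n ^ s)).filter (fun a => SCoprime s n a ∧ a ≡ 1 [MOD d ^ s])).card =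
      jordan s n := by
  have hdpos : 0 < d ^ s := pow_pos (Nat.pos_of_dvd_of_pos hd hn) s
  rw [jordan, jordan, ← smul_eq_mul, ← sum_const]
  rw [card_eq_sum_card_fiberwise (s := (range (n ^ s)).filter (SCoprime s n))
    (f := fun a => a % d ^ s)
    (t := (range (d ^ s)).filter (SCoprime s d))]
  · refine sum_congr rfl fun c hc => ?_
    simp only [mem_filter, mem_range] at hc
    rw [card_lifts_eq hn hd (sCoprime_one hs) hc.2, filter_filter]
    congr 1
    refine filter_congr fun a _ => ?_
    rw [Nat.ModEq, Nat.mod_eq_of_lt hc.1]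
  · intro a ha
    simp only [coe_filter, mem_range, Set.mem_ofPred_eq] at ha ⊢
    have h : SCoprime s d a := fun p hp hpd => ha.2 p hp (hpd.trans hd)
    exact ⟨Nat.mod_lt _ hdpos, h.of_modEq (Nat.mod_modEq a _).symm dvd_rfl⟩

lemma sroot_mul_eq_iff {s g k b : ℕ} (hg : 0 < g) (hk : 0 < k) :
    sroot s (g * k) (g ^ s * b) = g ↔ SCoprime s k b := by
  have hgk := Nat.mul_pos hg hk
  have key : ∀ e, e ∣ k → (g * e ∣ sroot s (g * k) (g ^ s * b) ↔ e ^ s ∣ b) := fun e he => by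
    rw [dvd_sroot_iff hgk (Nat.mul_dvd_mul_left g he), mul_pow,
      Nat.mul_dvd_mul_iff_left (pow_pos hg s)]
  constructor
  · intro h p hp hpk hpb
    have h1 := (key p hpk).2 hpb
    rw [h] at h1
    exact hp.one_lt.ne' (Nat.dvd_one.1 (Nat.dvd_of_mul_dvd_mul_left hg (by simpa using h1)))
  · intro h
    obtain ⟨e, he⟩ : g ∣ sroot s (g * k) (g ^ s * b) := by
      simpa using (key 1 (one_dvd k)).2 (by simp)
    have hek : e ∣ k := Nat.dvd_of_mul_dvd_mul_left hg (he ▸ sroot_dvd s (g * k) _)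
    have heb : e ^ s ∣ b := (key e hek).1 he.symm.dvd
    have he1 : e = 1 := by
      by_contra hne
      obtain ⟨p, hp, hpe⟩ := Nat.exists_prime_and_dvd hne
      exact h p hp (hpe.trans hek) ((pow_dvd_pow_of_dvd hpe s).trans heb)
    rw [he, he1, mul_one]

lemma card_sroot_eq {s g k : ℕ} (hg : 0 < g) (hk : 0 < k) :
    ((range ((g * k) ^ s)).filter (fun a => sroot s (g * k) a = g)).card = jordan s k := by
  have hgs := pow_pos hg s
  rw [jordan]
  refine (card_bij (fun b _ => g ^ s * b) ?_ ?_ ?_).symm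
  · intro b hb
    simp only [mem_filter, mem_range] at hb ⊢
    exact ⟨by rw [mul_pow]; exact Nat.mul_lt_mul_of_pos_left hb.1 hgs,
      (sroot_mul_eq_iff hg hk).2 hb.2⟩
  · intro b _ b' _ h
    exact Nat.eq_of_mul_eq_mul_left hgs h
  · intro a ha
    simp only [mem_filter, mem_range] at ha
    obtain ⟨b, rfl⟩ : g ^ s ∣ a := by
      have := sroot_pow_dvd s (g * k) a
      rwa [ha.2] at this
    refine ⟨b, mem_filter.2 ⟨mem_range.2 ?_, (sroot_mul_eq_iff hg hk).1 ha.2⟩, rfl⟩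
    exact Nat.lt_of_mul_lt_mul_left (by simpa [mul_pow] using ha.1)

lemma sum_divisors_jordan {m : ℕ} (hm : 0 < m) (s : ℕ) :
    ∑ d ∈ m.divisors, jordan s d = m ^ s := by
  rw [← Nat.sum_div_divisors]
  conv_rhs => rw [← card_range (m ^ s)]
  rw [card_eq_sum_card_fiberwise (f := sroot s m) (t := m.divisors)]
  · refine sum_congr rfl fun g hg => ?_
    obtain ⟨k, rfl⟩ := Nat.dvd_of_mem_divisors hg
    have hg0 : 0 < g := Nat.pos_of_ne_zero (by rintro rfl; simp at hm)
    have hk0 : 0 < k := Nat.pos_of_ne_zero (by rintro rfl; simp at hm)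
    rw [card_sroot_eq hg0 hk0, Nat.mul_div_cancel_left _ hg0]
  · intro a _
    exact Nat.mem_divisors.2 ⟨sroot_dvd s m a, hm.ne'⟩

lemma sgcd_eq_sum_jordan {n s : ℕ} (hn : 0 < n) (hs : 0 < s) (a : ℤ) :
    sgcd s a ((n : ℤ) ^ s) =
      ∑ d ∈ n.divisors, if d ^ s ∣ a.natAbs then jordan s d else 0 := by
  rw [sgcd_eq_sroot_pow hn hs, ← sum_divisors_jordan (sroot_pos hn), ← sum_filter]
  refine sum_congr ?_ fun _ _ => rfl
  ext d
  simp only [Nat.mem_divisors, mem_filter]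
  constructor
  · rintro ⟨h, -⟩
    have hdn := h.trans (sroot_dvd s n _)
    exact ⟨⟨hdn, hn.ne'⟩, (dvd_sroot_iff hn hdn).1 h⟩
  · rintro ⟨⟨hdn, -⟩, h⟩
    exact ⟨(dvd_sroot_iff hn hdn).2 h, (sroot_pos hn).ne'⟩

lemma tauS_pow {n s : ℕ} (hn : 0 < n) (hs : 0 < s) : tauS s (n ^ s) = n.divisors.card := by
  rw [tauS]
  congr 1
  ext d
  simp only [mem_filter, Nat.mem_divisors, Nat.pow_dvd_pow_iff hs.ne']
  exact ⟨fun h => ⟨h.2, hn.ne'⟩,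
    fun h => ⟨⟨h.1.trans (dvd_pow_self n hs.ne'), (pow_pos hn s).ne'⟩, h.1⟩⟩

theorem menon_type_identity (n s : ℕ) (hn : 0 < n) (hs : 0 < s) :
    ∑ a ∈ (Finset.Icc 1 (n ^ s)).filter (fun a => sgcd s (a : ℤ) ((n : ℤ) ^ s) = 1),
      sgcd s ((a : ℤ) - 1) ((n : ℤ) ^ s)
    = klee s (n ^ s) * tauS s (n ^ s) := by
  rw [bind_pure_natCast, filter_map, sum_map]
  simp only [Function.comp_def, Nat.castEmbedding_apply]
  rw [filter_congr fun a _ => sgcd_eq_one_iff hn hs a,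
    sum_congr rfl fun (a : ℕ) _ => sgcd_eq_sum_jordan hn hs ((a : ℤ) - 1)]
  rw [sum_comm, klee_eq_jordan hn hs, tauS_pow hn hs, mul_comm, ← smul_eq_mul, ← sum_const]
  refine sum_congr rfl fun d hd => ?_
  have hdn := Nat.dvd_of_mem_divisors hd
  rw [← jordan_mul_card_lifts hn hs hdn, ← card_filter_Icc_one_eq_range (periodic_sCoprime hdn 1),
    ← sum_filter, sum_const, smul_eq_mul, mul_comm, filter_filter]
  congr 2
  refine filter_congr fun a _ => and_congr_right fun _ => ?_
  rw [Nat.ModEq.comm, Nat.modEq_iff_dvd, ← Int.natCast_dvd, Nat.cast_one]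
end

section
/- For all positive integers n, s, and j, Σ_{b=1}^{n^s} (b, n^s)_s · e^{2πi b j / n^s} = Σ_{d : d^s | (j, n^s)_s} d^s · Φ_s(n^s / d^s), where the sum on the right is over positive integers d with d^s dividing (j, n^s)_s. -/
open scoped Classical

/-- The defining set of `sgcd` attains its supremum. -/
theorem sgcd_spec (s : ℕ) (a b : ℤ) (hb : b ≠ 0) :
    0 < sgcd s a b ∧ (∃ l : ℕ, sgcd s a b = l ^ s) ∧
      (sgcd s a b : ℤ) ∣ a ∧ (sgcd s a b : ℤ) ∣ b := by
  refine Nat.sSup_mem (s := {m : ℕ | 0 < m ∧ (∃ l : ℕ, m = l ^ s) ∧ (m : ℤ) ∣ a ∧ (m : ℤ) ∣ b})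
    ⟨1, by simp, ⟨1, by simp⟩, by simp, by simp⟩ ⟨b.natAbs, ?_⟩
  rintro m ⟨-, -, -, h⟩
  exact Nat.le_of_dvd (Int.natAbs_pos.2 hb) (Int.natCast_dvd.1 h)

theorem le_sgcd {s l : ℕ} {a b : ℤ} (hb : b ≠ 0) (hl : 0 < l) (h₁ : ((l ^ s : ℕ) : ℤ) ∣ a)
    (h₂ : ((l ^ s : ℕ) : ℤ) ∣ b) : l ^ s ≤ sgcd s a b := by
  refine le_csSup ⟨b.natAbs, ?_⟩ ⟨by positivity, ⟨l, rfl⟩, h₁, h₂⟩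
  rintro m ⟨-, -, -, h⟩
  exact Nat.le_of_dvd (Int.natAbs_pos.2 hb) (Int.natCast_dvd.1 h)

theorem pow_dvd_sgcd_iff {s : ℕ} (hs : 0 < s) (d a : ℕ) {b : ℕ} (hb : 0 < b) :
    d ^ s ∣ sgcd s (a : ℤ) (b : ℤ) ↔ d ^ s ∣ a ∧ d ^ s ∣ b := by
  have hb' : (b : ℤ) ≠ 0 := by exact_mod_cast hb.ne'
  obtain ⟨hpos, ⟨l, hl⟩, ha, hb₂⟩ := sgcd_spec s a b hb'
  rw [Int.natCast_dvd_natCast] at ha hb₂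
  refine ⟨fun h => ⟨h.trans ha, h.trans hb₂⟩, fun ⟨h₁, h₂⟩ => ?_⟩
  have hd : 0 < d := by
    rcases Nat.eq_zero_or_pos d with rfl | h
    · rw [zero_pow hs.ne'] at h₂
      exact absurd (Nat.eq_zero_of_zero_dvd h₂) hb.ne'
    · exact h
  have hlpos : 0 < l := by
    rcases Nat.eq_zero_or_pos l with rfl | h
    · rw [hl, zero_pow hs.ne'] at hpos
      exact absurd hpos (lt_irrefl _)
    · exact h
  rw [hl] at ha hb₂ ⊢
  have hlcm : (d.lcm l) ^ s = (d ^ s).lcm (l ^ s) := (Nat.pow_lcm_pow ..).symm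
  have hle : (d.lcm l) ^ s ≤ l ^ s := by
    conv_rhs => rw [← hl]
    refine le_sgcd hb' (Nat.lcm_pos hd hlpos) ?_ ?_ <;> rw [Int.natCast_dvd_natCast, hlcm]
    · exact Nat.lcm_dvd h₁ ha
    · exact Nat.lcm_dvd h₂ hb₂
  have hle' : d.lcm l ≤ l := (Nat.pow_le_pow_iff_left hs.ne').1 hle
  have : d.lcm l = l := le_antisymm hle' (Nat.le_of_dvd (Nat.lcm_pos hd hlpos) (Nat.dvd_lcm_right _ _))
  exact pow_dvd_pow_of_dvd (this ▸ Nat.dvd_lcm_left d l) s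

theorem sgcd_pow_mul {s : ℕ} (hs : 0 < s) {d : ℕ} (hd : 0 < d) (a : ℕ) {b : ℕ} (hb : 0 < b) :
    sgcd s ((d ^ s * a : ℕ) : ℤ) ((d ^ s * b : ℕ) : ℤ) = d ^ s * sgcd s (a : ℤ) (b : ℤ) := by
  have hds : 0 < d ^ s := by positivity
  have hdb : 0 < d ^ s * b := by positivity
  obtain ⟨-, ⟨k, hk⟩, hka, hkb⟩ := sgcd_spec s a b (by exact_mod_cast hb.ne')
  obtain ⟨-, ⟨l, hl⟩, hla, hlb⟩ := sgcd_spec s ((d ^ s * a : ℕ) : ℤ) ((d ^ s * b : ℕ) : ℤ)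
    (by exact_mod_cast hdb.ne')
  rw [Int.natCast_dvd_natCast] at hka hkb hla hlb
  apply Nat.dvd_antisymm
  · have h : d ^ s ∣ l ^ s := by
      rw [← hl, pow_dvd_sgcd_iff hs _ _ hdb]
      exact ⟨dvd_mul_right _ _, dvd_mul_right _ _⟩
    obtain ⟨m, rfl⟩ := (Nat.pow_dvd_pow_iff hs.ne').1 h
    rw [hl, mul_pow] at hla hlb ⊢
    refine mul_dvd_mul_left _ ((pow_dvd_sgcd_iff hs _ _ hb).2 ⟨?_, ?_⟩)
    · exact Nat.dvd_of_mul_dvd_mul_left hds hla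
    · exact Nat.dvd_of_mul_dvd_mul_left hds hlb
  · rw [hk] at hka hkb ⊢
    rw [← mul_pow, pow_dvd_sgcd_iff hs _ _ hdb, mul_pow]
    exact ⟨mul_dvd_mul_left _ hka, mul_dvd_mul_left _ hkb⟩

/-- `klee` counts integers that are casts of naturals; here it is a count of naturals. -/
theorem klee_eq_card (s n : ℕ) :
    klee s n =
      ((Finset.Icc 1 n).filter (fun m : ℕ => sgcd s (m : ℤ) (n : ℤ) = 1)).card := by
  rw [klee, ← Finset.card_image_of_injective _ (Nat.cast_injective (R := ℤ))]
  congr 1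
  ext m
  simp only [Finset.mem_filter, Finset.mem_image, Finset.bind_def, Finset.mem_sup,
    Finset.pure_def, Finset.mem_singleton]
  constructor
  · rintro ⟨⟨a, ha, rfl⟩, h⟩
    exact ⟨a, ⟨ha, h⟩, rfl⟩
  · rintro ⟨a, ⟨ha, h⟩, rfl⟩
    exact ⟨⟨a, ha, rfl⟩, h⟩

theorem card_filter_sgcd_eq_pow {s : ℕ} (hs : 0 < s) {d k : ℕ} (hd : 0 < d) (hk : 0 < k) :
    ((Finset.Icc 1 ((d * k) ^ s)).filter
      (fun m : ℕ => sgcd s (m : ℤ) (((d * k) ^ s : ℕ) : ℤ) = d ^ s)).card = klee s (k ^ s) := by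
  have hds : 0 < d ^ s := by positivity
  have hks : 0 < k ^ s := by positivity
  rw [klee_eq_card, mul_pow]
  symm
  refine Finset.card_bij (fun m _ => d ^ s * m) ?_ ?_ ?_
  · intro m hm
    simp only [Finset.mem_filter, Finset.mem_Icc] at hm ⊢
    refine ⟨⟨Nat.mul_pos hds hm.1.1, Nat.mul_le_mul_left _ hm.1.2⟩, ?_⟩
    rw [sgcd_pow_mul hs hd m hks, hm.2, mul_one]
  · intro a _ b _ h
    exact Nat.eq_of_mul_eq_mul_left hds h
  · intro m hm
    simp only [Finset.mem_filter, Finset.mem_Icc] at hm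
    obtain ⟨⟨h1, h2⟩, h3⟩ := hm
    obtain ⟨c, rfl⟩ : d ^ s ∣ m :=
      ((pow_dvd_sgcd_iff hs d m (Nat.mul_pos hds hks)).1 h3.symm.dvd).1
    refine ⟨c, ?_, rfl⟩
    rw [sgcd_pow_mul hs hd c hks] at h3
    simp only [Finset.mem_filter, Finset.mem_Icc]
    exact ⟨⟨Nat.pos_of_mul_pos_left h1, Nat.le_of_mul_le_mul_left h2 hds⟩,
      Nat.eq_of_mul_eq_mul_left hds (by rw [h3, mul_one])⟩

theorem sum_divisors_klee_pow {s : ℕ} (hs : 0 < s) {n : ℕ} (hn : 0 < n) :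
    ∑ d ∈ n.divisors, klee s (d ^ s) = n ^ s := by
  have hns : 0 < n ^ s := by positivity
  have hinj : Set.InjOn (fun d : ℕ => d ^ s) n.divisors :=
    fun a _ b _ h => Nat.pow_left_injective hs.ne' h
  have hmaps : ∀ m ∈ Finset.Icc 1 (n ^ s),
      sgcd s (m : ℤ) ((n ^ s : ℕ) : ℤ) ∈ n.divisors.image (fun d => d ^ s) := by
    intro m _
    obtain ⟨-, ⟨l, hl⟩, -, h⟩ := sgcd_spec s m ((n ^ s : ℕ) : ℤ) (by exact_mod_cast hns.ne')
    rw [hl, Int.natCast_dvd_natCast] at h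
    rw [hl]
    exact Finset.mem_image_of_mem (fun d => d ^ s)
      (Nat.mem_divisors.2 ⟨(Nat.pow_dvd_pow_iff hs.ne').1 h, hn.ne'⟩)
  have hcard := Finset.card_eq_sum_card_fiberwise hmaps
  rw [Nat.card_Icc, Nat.add_sub_cancel, Finset.sum_image hinj] at hcard
  rw [← Nat.sum_div_divisors n (fun d => klee s (d ^ s)), hcard]
  refine Finset.sum_congr rfl fun d hd => ?_
  obtain ⟨k, rfl⟩ := (Nat.mem_divisors.1 hd).1
  have hd0 := Nat.pos_of_mul_pos_right hn
  have hk0 := Nat.pos_of_mul_pos_left hn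
  rw [Nat.mul_div_cancel_left _ hd0, ← card_filter_sgcd_eq_pow hs hd0 hk0]

theorem sum_Icc_exp_two_pi_mul_I {N : ℕ} (hN : 0 < N) (j : ℕ) :
    ∑ c ∈ Finset.Icc 1 N, Complex.exp (2 * Real.pi * Complex.I * (c : ℂ) * (j : ℂ) / (N : ℂ)) =
      if N ∣ j then (N : ℂ) else 0 := by
  have hN0 : (N : ℂ) ≠ 0 := by exact_mod_cast hN.ne'
  set z : ℂ := Complex.exp (2 * Real.pi * Complex.I * (j : ℂ) / (N : ℂ)) with hz
  have hterm : ∀ c : ℕ,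
      Complex.exp (2 * Real.pi * Complex.I * (c : ℂ) * (j : ℂ) / (N : ℂ)) = z ^ c := by
    intro c
    rw [hz, ← Complex.exp_nat_mul]
    congr 1
    ring
  have hzN : z ^ N = 1 := by
    rw [← hterm, Complex.exp_eq_one_iff]
    refine ⟨j, ?_⟩
    push_cast
    field_simp
  have hz1 : z = 1 ↔ N ∣ j := by
    rw [hz, Complex.exp_eq_one_iff]
    constructor
    · rintro ⟨k, hk⟩
      have h : (j : ℂ) = k * N := by
        field_simp at hk
        linear_combination hk
      have h' : (j : ℤ) = k * N := by exact_mod_cast h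
      exact Int.natCast_dvd_natCast.1 ⟨k, by rw [h', mul_comm]⟩
    · rintro ⟨k, rfl⟩
      refine ⟨k, ?_⟩
      push_cast
      field_simp
  simp_rw [hterm]
  split_ifs with h
  · simp [hz1.2 h]
  · have hgeom : (∑ c ∈ Finset.range N, z ^ c) = 0 := by
      have h2 := geom_sum_mul z N
      rw [hzN, sub_self] at h2
      exact (mul_eq_zero.1 h2).resolve_right (sub_ne_zero.2 (mt hz1.1 h))
    have h3 : ∑ c ∈ Finset.Icc 1 N, z ^ c = ∑ c ∈ Finset.range N, z ^ (c + 1) := by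
      rw [Finset.range_eq_Ico, Finset.sum_Ico_add' (fun c => z ^ c) 0 N 1]
      rfl
    simp_rw [h3, pow_succ, ← Finset.sum_mul, hgeom, zero_mul]

theorem sum_filter_dvd_Icc {M : Type*} [AddCommMonoid M] {d : ℕ} (hd : 0 < d) (k : ℕ)
    (f : ℕ → M) :
    ∑ b ∈ (Finset.Icc 1 (d * k)).filter (d ∣ ·), f b = ∑ c ∈ Finset.Icc 1 k, f (d * c) := by
  symm
  refine Finset.sum_bij (fun c _ => d * c) ?_ ?_ ?_ (fun _ _ => rfl)
  · intro c hc
    simp only [Finset.mem_filter, Finset.mem_Icc] at hc ⊢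
    exact ⟨⟨Nat.mul_pos hd hc.1, Nat.mul_le_mul_left _ hc.2⟩, dvd_mul_right _ _⟩
  · intro a _ b _ h
    exact Nat.eq_of_mul_eq_mul_left hd h
  · intro b hb
    simp only [Finset.mem_filter, Finset.mem_Icc] at hb
    obtain ⟨⟨h1, h2⟩, c, rfl⟩ := hb
    exact ⟨c, Finset.mem_Icc.2 ⟨Nat.pos_of_mul_pos_left h1, Nat.le_of_mul_le_mul_left h2 hd⟩, rfl⟩

theorem sgcd_eq_sum_klee {s : ℕ} (hs : 0 < s) {n : ℕ} (hn : 0 < n) (b : ℕ) :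
    sgcd s (b : ℤ) ((n ^ s : ℕ) : ℤ) =
      ∑ d ∈ n.divisors, if d ^ s ∣ b then klee s (d ^ s) else 0 := by
  have hns : 0 < n ^ s := by positivity
  obtain ⟨hpos, ⟨l, hl⟩, -, -⟩ := sgcd_spec s b ((n ^ s : ℕ) : ℤ) (by exact_mod_cast hns.ne')
  have hl0 : 0 < l := by
    rcases Nat.eq_zero_or_pos l with rfl | h
    · rw [hl, zero_pow hs.ne'] at hpos
      exact absurd hpos (lt_irrefl _)
    · exact h
  rw [hl, ← sum_divisors_klee_pow hs hl0, ← Finset.sum_filter]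
  refine Finset.sum_congr ?_ fun _ _ => rfl
  ext d
  have h := pow_dvd_sgcd_iff hs d b hns
  rw [hl, Nat.pow_dvd_pow_iff hs.ne', Nat.pow_dvd_pow_iff hs.ne'] at h
  simp [h, hl0.ne', hn.ne', and_comm]

theorem sgcd_exp_sum (n s j : ℕ) (hn : 0 < n) (hs : 0 < s) (hj : 0 < j) :
    ∑ b ∈ Finset.Icc 1 (n ^ s),
      (sgcd s (b : ℤ) ((n : ℤ) ^ s) : ℂ) *
        Complex.exp (2 * Real.pi * Complex.I * (b : ℂ) * (j : ℂ) / (n : ℂ) ^ s)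
    = ∑ d ∈ (sgcd s (j : ℤ) ((n : ℤ) ^ s)).divisors.filter
        (fun d => d ^ s ∣ sgcd s (j : ℤ) ((n : ℤ) ^ s)),
        ((d : ℂ) ^ s) * (klee s (n ^ s / d ^ s) : ℂ) := by
  have hns : 0 < n ^ s := by positivity
  simp only [← Nat.cast_pow]
  have hindex : (sgcd s (j : ℤ) ((n ^ s : ℕ) : ℤ)).divisors.filter
      (fun d => d ^ s ∣ sgcd s (j : ℤ) ((n ^ s : ℕ) : ℤ)) =
      n.divisors.filter (fun d => d ^ s ∣ j) := by
    ext d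
    have hpos := (sgcd_spec s j ((n ^ s : ℕ) : ℤ) (by exact_mod_cast hns.ne')).1
    have h := pow_dvd_sgcd_iff hs d j hns
    rw [Nat.pow_dvd_pow_iff hs.ne'] at h
    simp only [Finset.mem_filter, Nat.mem_divisors]
    constructor
    · rintro ⟨-, h2⟩
      exact ⟨⟨(h.1 h2).2, hn.ne'⟩, (h.1 h2).1⟩
    · rintro ⟨⟨h1, -⟩, h2⟩
      have h3 := h.2 ⟨h2, h1⟩
      exact ⟨⟨(dvd_pow_self d hs.ne').trans h3, hpos.ne'⟩, h3⟩
  rw [hindex, Finset.sum_filter]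
  simp_rw [sgcd_eq_sum_klee hs hn, Nat.cast_sum, Finset.sum_mul]
  rw [Finset.sum_comm, ← Nat.sum_div_divisors n]
  refine Finset.sum_congr rfl fun d hd => ?_
  obtain ⟨k, rfl⟩ := (Nat.mem_divisors.1 hd).1
  have hd0 := Nat.pos_of_mul_pos_right hn
  have hk0 := Nat.pos_of_mul_pos_left hn
  have hks : 0 < k ^ s := by positivity
  have hds : 0 < d ^ s := by positivity
  have hkC : ((k ^ s : ℕ) : ℂ) ≠ 0 := by exact_mod_cast hks.ne'
  rw [Nat.mul_div_cancel_left _ hd0, mul_comm d k, mul_pow, Nat.mul_div_cancel _ hds]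
  have hsum : ∀ b ∈ Finset.Icc 1 (k ^ s * d ^ s),
      (((if k ^ s ∣ b then klee s (k ^ s) else 0 : ℕ) : ℂ) *
        Complex.exp (2 * Real.pi * Complex.I * (b : ℂ) * (j : ℂ) / ((k ^ s * d ^ s : ℕ) : ℂ))) =
      if k ^ s ∣ b then (klee s (k ^ s) : ℂ) *
        Complex.exp (2 * Real.pi * Complex.I * (b : ℂ) * (j : ℂ) / ((k ^ s * d ^ s : ℕ) : ℂ))
      else 0 := by
    intro b _
    split_ifs <;> simp
  rw [Finset.sum_congr rfl hsum, ← Finset.sum_filter, sum_filter_dvd_Icc hks, ← Finset.mul_sum]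
  have hexp : ∀ c : ℕ, Complex.exp (2 * Real.pi * Complex.I * ((k ^ s * c : ℕ) : ℂ) * (j : ℂ) /
      ((k ^ s * d ^ s : ℕ) : ℂ)) =
      Complex.exp (2 * Real.pi * Complex.I * (c : ℂ) * (j : ℂ) / ((d ^ s : ℕ) : ℂ)) := by
    intro c
    congr 1
    rw [Nat.cast_mul, Nat.cast_mul, ← mul_div_mul_left _ ((d ^ s : ℕ) : ℂ) hkC]
    ring
  simp_rw [hexp, sum_Icc_exp_two_pi_mul_I hds]
  split_ifs <;> simp [mul_comm]
end
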